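/- arXiv:math/0603583 — 3 statements merged into one kernel-verified Lean document; each statement's English description precedes it below -/
import Mathlib

section
/- Let 2 ≤ m ≤ n, and let A be an m×n matrix with nonnegative real entries whose maximum entry is α. If ‖A‖₁ ≥ n·α, then E(A) ≤ ‖A‖₁/√(mn) + √((m−1)·(tr(AAᵀ) − ‖A‖₁²/(mn))). -/
open Matrix

/-- The singular values of a real `m × n` matrix `A`, listed in decreasing order:
`singularValues A i` is the `i`-th largest square root of an eigenvalue of `A * Aᵀ`
(over `ℝ`, `Aᴴ = Aᵀ`). -/
noncomputable def singularValues {m n : ℕ} (A : Matrix (Fin m) (Fin n) ℝ) : Fin m → ℝ :=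
  fun i =>
    Real.sqrt ((Matrix.isHermitian_mul_conjTranspose_self A).eigenvalues
      (Tuple.sort (Matrix.isHermitian_mul_conjTranspose_self A).eigenvalues i.rev))

/-- The energy of a matrix: the sum of its singular values. -/
noncomputable def energy {m n : ℕ} (A : Matrix (Fin m) (Fin n) ℝ) : ℝ :=
  ∑ i, singularValues A i

/-- The entrywise ℓ¹-norm of a matrix: the sum of the absolute values of its entries. -/
noncomputable def norm1 {m n : ℕ} (A : Matrix (Fin m) (Fin n) ℝ) : ℝ :=
  ∑ i, ∑ j, |A i j|

/-- The energy does not depend on the order in which the eigenvalues of `A * Aᴴ` are listed. -/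
lemma energy_eq_sum_sqrt_eigenvalues {m n : ℕ} (A : Matrix (Fin m) (Fin n) ℝ) :
    energy A = ∑ i, √((Matrix.isHermitian_mul_conjTranspose_self A).eigenvalues i) := by
  unfold energy singularValues
  exact Equiv.sum_comp
    (Fin.revPerm.trans (Tuple.sort (Matrix.isHermitian_mul_conjTranspose_self A).eigenvalues))
    (fun i => √((Matrix.isHermitian_mul_conjTranspose_self A).eigenvalues i))

/-- The Rayleigh quotient of a real symmetric matrix is at most any upper bound of its
eigenvalues. -/
lemma Matrix.IsHermitian.dotProduct_mulVec_le {ι : Type*} [Fintype ι] [DecidableEq ι]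
    {M : Matrix ι ι ℝ} (hM : M.IsHermitian) {c : ℝ} (hc : ∀ i, hM.eigenvalues i ≤ c)
    (x : ι → ℝ) : x ⬝ᵥ M *ᵥ x ≤ c * (x ⬝ᵥ x) := by
  set b := hM.eigenvectorBasis
  have key (i : ι) : inner ℝ (b i) (WithLp.toLp 2 (M *ᵥ x)) =
      hM.eigenvalues i * inner ℝ (b i) (WithLp.toLp 2 x) := by
    have h := hM.mulVec_eigenvectorBasis i
    have hT : Mᵀ = M := by simpa using hM.eq
    simp only [EuclideanSpace.inner_eq_star_dotProduct, star_trivial]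
    rw [dotProduct_comm, dotProduct_mulVec, ← mulVec_transpose, hT, h, smul_dotProduct,
      dotProduct_comm, smul_eq_mul]
  have h1 := b.sum_inner_mul_inner (WithLp.toLp 2 x) (WithLp.toLp 2 (M *ᵥ x))
  have h2 := b.sum_inner_mul_inner (WithLp.toLp 2 x) (WithLp.toLp 2 x)
  have e1 : inner ℝ (WithLp.toLp 2 x) (WithLp.toLp 2 (M *ᵥ x)) = x ⬝ᵥ M *ᵥ x := by
    simp [EuclideanSpace.inner_eq_star_dotProduct, dotProduct_comm]
  have e2 : inner ℝ (WithLp.toLp 2 x) (WithLp.toLp 2 x) = x ⬝ᵥ x := by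
    rw [EuclideanSpace.inner_eq_star_dotProduct, star_trivial]
  rw [← e1, ← e2, ← h1, ← h2, Finset.mul_sum]
  refine Finset.sum_le_sum fun i _ => ?_
  rw [key, real_inner_comm (b i)]
  nlinarith [mul_le_mul_of_nonneg_right (hc i)
    (mul_self_nonneg (inner ℝ (b i) (WithLp.toLp 2 x)))]

/-- The function `x ↦ x + √(k * (T - x ^ 2))` is decreasing where `T ≤ (k + 1) * x ^ 2`. -/
lemma add_sqrt_mul_sub_sq_anti {k T x y : ℝ} (hk : 0 ≤ k) (hy : 0 ≤ y) (hyx : y ≤ x)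
    (hx : x ^ 2 ≤ T) (hT : T ≤ (k + 1) * y ^ 2) :
    x + √(k * (T - x ^ 2)) ≤ y + √(k * (T - y ^ 2)) := by
  have hxy : y ^ 2 ≤ x ^ 2 := by gcongr
  rw [Real.sqrt_mul hk, Real.sqrt_mul hk]
  have hs := Real.sq_sqrt hk
  have ha := Real.sq_sqrt (sub_nonneg.2 hx)
  have hb := Real.sq_sqrt (sub_nonneg.2 (hxy.trans hx))
  have hs0 := Real.sqrt_nonneg k
  have ha0 := Real.sqrt_nonneg (T - x ^ 2)
  have hab : √(T - x ^ 2) ≤ √(T - y ^ 2) := Real.sqrt_le_sqrt (by linarith)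
  generalize √k = s at *
  generalize √(T - x ^ 2) = a at *
  generalize √(T - y ^ 2) = b at *
  have hby : b ≤ s * y := by
    refine abs_le_of_sq_le_sq' ?_ (by positivity) |>.2
    rw [mul_pow, hs, hb]
    linarith
  have hsum : a + b ≤ s * (x + y) := by
    have := mul_le_mul_of_nonneg_left hyx hs0
    linarith
  rcases (add_nonneg ha0 (ha0.trans hab)).eq_or_lt with h | h
  · have : x ^ 2 = y ^ 2 := by
      have h₁ : a = 0 := by linarith
      have h₂ : b = 0 := by linarith
      subst h₁ h₂
      linarith
    have : x = y := by nlinarith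
    nlinarith
  · have h₃ : (x - y) * (a + b) ≤ s * (b - a) * (a + b) := by
      have := mul_le_mul_of_nonneg_left hsum (sub_nonneg.2 hyx)
      calc (x - y) * (a + b) ≤ (x - y) * (s * (x + y)) := this
        _ = s * (x ^ 2 - y ^ 2) := by ring
        _ = s * (b ^ 2 - a ^ 2) := by rw [ha, hb]; ring
        _ = s * (b - a) * (a + b) := by ring
    have := le_of_mul_le_mul_right h₃ h
    linarith

/-- A sum of square roots is bounded by separating one term and applying Cauchy–Schwarz to the
remaining ones. -/
lemma sum_sqrt_le_sqrt_add_sqrt {ι : Type*} [Fintype ι] [DecidableEq ι] {f : ι → ℝ}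
    (hf : ∀ i, 0 ≤ f i) (i₀ : ι) :
    ∑ i, √(f i) ≤ √(f i₀) + √(((Fintype.card ι : ℝ) - 1) * (∑ i, f i - f i₀)) := by
  rw [← Finset.add_sum_erase _ _ (Finset.mem_univ i₀),
    ← Finset.add_sum_erase _ f (Finset.mem_univ i₀), add_sub_cancel_left]
  gcongr
  refine Real.le_sqrt_of_sq_le ?_
  have h := sq_sum_le_card_mul_sum_sq (s := Finset.univ.erase i₀) (f := fun i => √(f i))
  simp only [Real.sq_sqrt (hf _)] at h
  rwa [Finset.card_erase_of_mem (Finset.mem_univ i₀), Finset.card_univ,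
    Nat.cast_pred (Fintype.card_pos_iff.2 ⟨i₀⟩)] at h

/-- The largest eigenvalue of `A * Aᴴ` is at least `(∑ i, ∑ j, A i j) ^ 2 / (m * n)`. -/
lemma sq_sum_le_mul_of_eigenvalues_le {m n : ℕ} (A : Matrix (Fin m) (Fin n) ℝ) {c : ℝ}
    (hc : ∀ i, (Matrix.isHermitian_mul_conjTranspose_self A).eigenvalues i ≤ c) :
    (∑ i, ∑ j, A i j) ^ 2 ≤ c * (m * n) := by
  have h := (Matrix.isHermitian_mul_conjTranspose_self A).dotProduct_mulVec_le hc 1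
  have e : (1 : Fin m → ℝ) ⬝ᵥ (A * Aᴴ) *ᵥ 1 = ∑ j, (∑ i, A i j) ^ 2 := by
    rw [← mulVec_mulVec, dotProduct_mulVec, conjTranspose_eq_transpose_of_trivial,
      mulVec_transpose]
    simp [dotProduct, vecMul, sq]
  have hcs := sq_sum_le_card_mul_sum_sq (s := Finset.univ) (f := fun j => ∑ i, A i j)
  rw [e] at h
  simp only [one_dotProduct_one, Fintype.card_fin, Finset.card_univ] at h hcs
  calc (∑ i, ∑ j, A i j) ^ 2 = (∑ j, ∑ i, A i j) ^ 2 := congrArg (· ^ 2) Finset.sum_comm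
    _ ≤ (n : ℝ) * ∑ j, (∑ i, A i j) ^ 2 := hcs
    _ ≤ n * (c * m) := by gcongr
    _ = c * (m * n) := by ring

/-- Theorem 1 of the paper. If `2 ≤ m ≤ n` and `A` is an `m × n`
nonnegative real matrix with maximum entry `α` satisfying `‖A‖₁ ≥ n·α`, then
`E(A) ≤ ‖A‖₁/√(mn) + √((m-1)·(tr(AAᵀ) - ‖A‖₁²/(mn)))`. -/
theorem energy_le_of_norm1_ge {m n : ℕ} (hm : 2 ≤ m) (hmn : m ≤ n)
    (A : Matrix (Fin m) (Fin n) ℝ) (α : ℝ)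
    (hnonneg : ∀ i j, 0 ≤ A i j) (hmax_le : ∀ i j, A i j ≤ α)
    (hmax_ex : ∃ i j, A i j = α) (h1 : (n : ℝ) * α ≤ norm1 A) :
    energy A ≤ norm1 A / Real.sqrt (m * n) +
      Real.sqrt (((m : ℝ) - 1) * (Matrix.trace (A * Aᵀ) - (norm1 A) ^ 2 / (m * n))) := by
  have hm0 : (2 : ℝ) ≤ m := by exact_mod_cast hm
  have hn0 : (2 : ℝ) ≤ n := by exact_mod_cast hm.trans hmn
  have hmn0 : (0 : ℝ) < m * n := by positivity
  have hS : norm1 A = ∑ i, ∑ j, A i j := by simp [norm1, abs_of_nonneg (hnonneg _ _)]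
  have hS0 : 0 ≤ norm1 A := by
    rw [hS]
    exact Finset.sum_nonneg fun i _ => Finset.sum_nonneg fun j _ => hnonneg i j
  have hT : Matrix.trace (A * Aᵀ) ≤ α * norm1 A := by
    simp only [hS, trace, diag_apply, mul_apply, transpose_apply, Finset.mul_sum]
    gcongr with i _ j _
    · exact hnonneg i j
    · exact hmax_le i j
  have hA := Matrix.isHermitian_mul_conjTranspose_self A
  have hl0 : ∀ i, 0 ≤ hA.eigenvalues i := (posSemidef_self_mul_conjTranspose A).eigenvalues_nonneg
  have hsum : ∑ i, hA.eigenvalues i = Matrix.trace (A * Aᵀ) := by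
    have := hA.trace_eq_sum_eigenvalues
    simpa using this.symm
  have : Nonempty (Fin m) := ⟨⟨0, by omega⟩⟩
  obtain ⟨i₀, hi₀⟩ := Finite.exists_max hA.eigenvalues
  have hray := sq_sum_le_mul_of_eigenvalues_le A hi₀
  rw [← hS] at hray
  have hsq : (norm1 A / √(m * n)) ^ 2 = norm1 A ^ 2 / (m * n) := by
    rw [div_pow, Real.sq_sqrt hmn0.le]
  rw [energy_eq_sum_sqrt_eigenvalues]
  refine (sum_sqrt_le_sqrt_add_sqrt hl0 i₀).trans ?_
  rw [Fintype.card_fin, hsum, ← hsq]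
  nth_rewrite 2 [← Real.sq_sqrt (hl0 i₀)]
  apply add_sqrt_mul_sub_sq_anti
  · linarith
  · positivity
  · refine Real.le_sqrt_of_sq_le ?_
    rwa [hsq, div_le_iff₀ hmn0]
  · rw [Real.sq_sqrt (hl0 i₀), ← hsum]
    exact Finset.single_le_sum (fun i _ => hl0 i) (Finset.mem_univ i₀)
  · rw [hsq, sub_add_cancel, ← mul_div_assoc, mul_div_mul_left _ _ (by positivity),
      le_div_iff₀ (by positivity)]
    nlinarith [mul_le_mul_of_nonneg_right h1 hS0, mul_le_mul_of_nonneg_right hT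
      (by positivity : (0 : ℝ) ≤ n)]
end

section
/- Let m ≤ n, and let A be an m×n matrix with nonnegative real entries whose maximum entry is α. If ‖A‖₁ < n·α, then E(A) ≤ √(mn)·α. -/
open Matrix

/-- The square of the energy is at most `m` times the squared Frobenius norm. -/
theorem energy_sq_le {m n : ℕ} (A : Matrix (Fin m) (Fin n) ℝ) :
    energy A ^ 2 ≤ m * ∑ i, ∑ j, A i j ^ 2 := by
  have hH := Matrix.isHermitian_mul_conjTranspose_self A
  have hsum : ∑ i, singularValues A i ^ 2 = ∑ i, ∑ j, A i j ^ 2 := by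
    calc ∑ i, singularValues A i ^ 2
        = ∑ i, hH.eigenvalues (Fin.revPerm.trans (Tuple.sort hH.eigenvalues) i) :=
          Finset.sum_congr rfl fun i _ =>
            Real.sq_sqrt ((Matrix.posSemidef_self_mul_conjTranspose A).eigenvalues_nonneg _)
      _ = ∑ i, hH.eigenvalues i := Equiv.sum_comp _ _
      _ = (A * Aᴴ).trace := by simpa using hH.trace_eq_sum_eigenvalues.symm
      _ = ∑ i, ∑ j, A i j ^ 2 := by
          simp [Matrix.trace, Matrix.mul_apply, sq]
  simpa [energy, hsum] using
    sq_sum_le_card_mul_sum_sq (s := Finset.univ) (f := singularValues A)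

/-- If `m ≤ n` and `A` is an `m × n` nonnegative real matrix with
maximum entry `α` satisfying `‖A‖₁ < n·α`, then `E(A) ≤ √(mn)·α`. -/
theorem energy_le_of_norm1_lt {m n : ℕ} (hmn : m ≤ n)
    (A : Matrix (Fin m) (Fin n) ℝ) (α : ℝ)
    (hnonneg : ∀ i j, 0 ≤ A i j) (hmax_le : ∀ i j, A i j ≤ α)
    (hmax_ex : ∃ i j, A i j = α) (h1 : norm1 A < (n : ℝ) * α) :
    energy A ≤ Real.sqrt (m * n) * α := by
  obtain ⟨i₀, j₀, h₀⟩ := hmax_ex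
  have hα : 0 ≤ α := h₀ ▸ hnonneg i₀ j₀
  have hF : ∑ i, ∑ j, A i j ^ 2 ≤ α * norm1 A := by
    simp only [norm1, Finset.mul_sum]
    refine Finset.sum_le_sum fun i _ => Finset.sum_le_sum fun j _ => ?_
    rw [abs_of_nonneg (hnonneg i j), sq]
    exact mul_le_mul_of_nonneg_right (hmax_le i j) (hnonneg i j)
  refine (abs_le_of_sq_le_sq' ?_ (by positivity)).2
  calc energy A ^ 2 ≤ m * ∑ i, ∑ j, A i j ^ 2 := energy_sq_le A
    _ ≤ m * (α * (n * α)) := by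
        gcongr
        exact hF.trans (mul_le_mul_of_nonneg_left h1.le hα)
    _ = (Real.sqrt (m * n) * α) ^ 2 := by
        rw [mul_pow, Real.sq_sqrt (by positivity)]
        ring
end

section
/- Let m, n ≥ 1 be integers and α ≥ 0 a real number. For every real s with 0 ≤ s ≤ m·n·α, one has s/√(mn) + √((m−1)·(α·s − s²/(mn))) ≤ α·(m + √m)·√n / 2, with equality when s = (m + √m)·α·n/2. -/
/-- If `a ≥ 1`, then `t + √((a² - 1)(c t - t²))` is at most `c (a + 1) / 2` for `0 ≤ t ≤ c`. -/
theorem add_sqrt_le_mul_half {a c t : ℝ} (ha : 1 ≤ a) (ht : 0 ≤ t) (htc : t ≤ c) :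
    t + Real.sqrt ((a ^ 2 - 1) * (c * t - t ^ 2)) ≤ c * (a + 1) / 2 := by
  have h : Real.sqrt ((a ^ 2 - 1) * (c * t - t ^ 2)) ≤ c * (a + 1) / 2 - t := by
    apply Real.sqrt_le_iff.mpr
    constructor
    · nlinarith [mul_nonneg (ht.trans htc) (sub_nonneg.mpr ha)]
    · nlinarith [sq_nonneg (a * t - c * (a + 1) / 2)]
  linarith

/-- For integers `m, n ≥ 1` and a real `α ≥ 0`, the function
`s ↦ s/√(mn) + √((m-1)·(α·s - s²/(mn)))` is bounded above on `[0, mnα]` by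
`α·(m + √m)·√n / 2`, with equality at `s = (m + √m)·α·n/2`. -/
theorem aux_max (m n : ℕ) (hm : 1 ≤ m) (hn : 1 ≤ n) (α : ℝ) (hα : 0 ≤ α) :
    (∀ s : ℝ, 0 ≤ s → s ≤ (m : ℝ) * n * α →
      s / Real.sqrt (m * n) + Real.sqrt (((m : ℝ) - 1) * (α * s - s ^ 2 / (m * n))) ≤
        α * ((m : ℝ) + Real.sqrt m) * Real.sqrt n / 2) ∧
    (((m : ℝ) + Real.sqrt m) * α * n / 2) / Real.sqrt (m * n) +
        Real.sqrt (((m : ℝ) - 1) * (α * (((m : ℝ) + Real.sqrt m) * α * n / 2) -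
          (((m : ℝ) + Real.sqrt m) * α * n / 2) ^ 2 / (m * n))) =
      α * ((m : ℝ) + Real.sqrt m) * Real.sqrt n / 2 := by
  have ha : 1 ≤ Real.sqrt m := Real.one_le_sqrt.mpr (by exact_mod_cast hm)
  have hb : 0 < Real.sqrt n := Real.sqrt_pos.mpr (by exact_mod_cast hn)
  have hma : (m : ℝ) = Real.sqrt m ^ 2 := (Real.sq_sqrt m.cast_nonneg).symm
  have hnb : (n : ℝ) = Real.sqrt n ^ 2 := (Real.sq_sqrt n.cast_nonneg).symm
  rw [Real.sqrt_mul m.cast_nonneg]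
  generalize Real.sqrt m = a at *
  generalize Real.sqrt n = b at *
  rw [hma, hnb]
  have ha0 : 0 < a := by linarith
  constructor
  · intro s hs hs'
    have h := add_sqrt_le_mul_half (c := α * a * b) ha (div_nonneg hs (mul_pos ha0 hb).le)
      ((div_le_iff₀ (mul_pos ha0 hb)).mpr (by linarith))
    convert h using 1
    · congr 3
      field_simp
    · ring
  · have h : (a ^ 2 - 1) * (α * ((a ^ 2 + a) * α * b ^ 2 / 2) -
        ((a ^ 2 + a) * α * b ^ 2 / 2) ^ 2 / (a ^ 2 * b ^ 2)) =
        (α * b * (a ^ 2 - 1) / 2) ^ 2 := by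
      field_simp
      ring
    have h' : 0 ≤ α * b * (a ^ 2 - 1) / 2 := by
      have : 0 ≤ a ^ 2 - 1 := by nlinarith
      positivity
    rw [h, Real.sqrt_sq h']
    field_simp
    ring
end
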